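/- Let α₁, α₂ > 0, let φ_p(s) = |s|^{p−1}·s, and let q be continuous on [a,b]. Suppose u is a nontrivial solution of the quasilinear equation (φ_{α₂}((φ_{α₁}(u'))'))' + q(x)·φ_{α₁α₂}(u) = 0 on [a,b], and t₁ < t₂ < ⋯ < t_{2N+1} (N ∈ ℕ, N ≥ 1) are zeros of u in [a,b] with u(x) ≠ 0 between consecutive zeros. Then Σ_{k=1}^{N} max_{ξ_k ∈ [t_{2k−1}, t_{2k+1}]} { ∫_{t_{2k−1}}^{ξ_k} q₋(x) dx + ∫_{ξ_k}^{t_{2k+1}} q₊(x) dx } > (2/(b−a))^{α₂(α₁+1)} · N^{α₂(α₁+1)+1}. -/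

import Mathlib

open Set

open MeasureTheory

/-- The signed power `φ_p(s) = |s| ^ (p - 1) * s`. -/
noncomputable def signedPow (p s : ℝ) : ℝ := |s| ^ (p - 1) * s

lemma signedPow_of_pos {p s : ℝ} (hs : 0 < s) : signedPow p s = s ^ p := by
  rw [signedPow, abs_of_pos hs, Real.rpow_sub_one hs.ne', div_mul_cancel₀ _ hs.ne']

@[simp] lemma signedPow_zero (p : ℝ) : signedPow p 0 = 0 := by simp [signedPow]

lemma signedPow_neg (p s : ℝ) : signedPow p (-s) = -signedPow p s := by simp [signedPow]

lemma signedPow_nonneg {p s : ℝ} (hs : 0 ≤ s) : 0 ≤ signedPow p s := by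
  unfold signedPow; positivity

lemma signedPow_le {p s M : ℝ} (hp : 0 < p) (hM : 0 ≤ M) (h : s ≤ M) : signedPow p s ≤ M ^ p := by
  rcases lt_or_ge 0 s with hs | hs
  · rw [signedPow_of_pos hs]
    exact Real.rpow_le_rpow hs.le h hp.le
  · have := signedPow_nonneg (p := p) (neg_nonneg.2 hs)
    rw [signedPow_neg] at this
    have := Real.rpow_nonneg hM p
    linarith

lemma le_of_signedPow_le {p s R : ℝ} (hp : 0 < p) (hR : 0 ≤ R) (h : signedPow p s ≤ R ^ p) :
    s ≤ R := by
  rcases lt_or_ge 0 s with hs | hs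
  · rw [signedPow_of_pos hs] at h
    exact (Real.rpow_le_rpow_iff hs.le hR hp).1 h
  · exact hs.trans hR

/-- The weight equal to `q₋` up to `ξ` and to `q₊` after `ξ`. -/
noncomputable def splitWeight (q : ℝ → ℝ) (ξ s : ℝ) : ℝ :=
  if s ≤ ξ then max (-q s) 0 else max (q s) 0

lemma splitWeight_nonneg (q : ℝ → ℝ) (ξ s : ℝ) : 0 ≤ splitWeight q ξ s := by
  unfold splitWeight; split_ifs <;> exact le_max_right _ _

section Weight

variable {q : ℝ → ℝ} {A B ξ : ℝ}

lemma integrableOn_splitWeight (hq : ContinuousOn q (Icc A B)) :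
    IntegrableOn (splitWeight q ξ) (Icc A B) := by
  have h1 : IntegrableOn (fun s => max (-q s) 0) (Icc A B) :=
    (hq.neg.sup continuousOn_const).integrableOn_Icc
  have h2 : IntegrableOn (fun s => max (q s) 0) (Icc A B) :=
    (hq.sup continuousOn_const).integrableOn_Icc
  exact Integrable.piecewise (s := Iic ξ) measurableSet_Iic h1.integrableOn h2.integrableOn

lemma integral_splitWeight (hq : ContinuousOn q (Icc A B)) (hξ : ξ ∈ Icc A B) :
    ∫ s in A..B, splitWeight q ξ s =
      (∫ s in A..ξ, max (-q s) 0) + ∫ s in ξ..B, max (q s) 0 := by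
  have hi := integrableOn_splitWeight (ξ := ξ) hq
  have h1 : IntervalIntegrable (splitWeight q ξ) volume A ξ :=
    (intervalIntegrable_iff_integrableOn_Icc_of_le hξ.1).2 (hi.mono_set (Icc_subset_Icc_right hξ.2))
  have h2 : IntervalIntegrable (splitWeight q ξ) volume ξ B :=
    (intervalIntegrable_iff_integrableOn_Icc_of_le hξ.2).2 (hi.mono_set (Icc_subset_Icc_left hξ.1))
  rw [← intervalIntegral.integral_add_adjacent_intervals h1 h2]
  congr 1
  · rw [intervalIntegral.integral_of_le hξ.1, intervalIntegral.integral_of_le hξ.1]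
    refine setIntegral_congr_fun measurableSet_Ioc fun s hs => ?_
    simp [splitWeight, hs.2]
  · rw [intervalIntegral.integral_of_le hξ.2, intervalIntegral.integral_of_le hξ.2]
    refine setIntegral_congr_fun measurableSet_Ioc fun s hs => ?_
    simp [splitWeight, not_le.2 hs.1]

lemma integral_splitWeight_nonneg (hAB : A ≤ B) : 0 ≤ ∫ s in A..B, splitWeight q ξ s :=
  intervalIntegral.integral_nonneg hAB fun _ _ => splitWeight_nonneg _ _ _

lemma sub_le_mul_integral_splitWeight {f f' : ℝ → ℝ} {C x y : ℝ} (hq : ContinuousOn q (Icc A B))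
    (hC : 0 ≤ C) (hf : ∀ s, HasDerivAt f (f' s) s) (hAx : A ≤ x) (hxy : x ≤ y) (hyB : y ≤ B)
    (hle : ∀ s ∈ Ioo x y, f' s ≤ C * splitWeight q ξ s) :
    f y - f x ≤ C * ∫ s in A..B, splitWeight q ξ s := by
  have hi := integrableOn_splitWeight (ξ := ξ) hq
  have h := intervalIntegral.sub_le_integral_of_hasDeriv_right_of_le hxy
    (fun s _ => (hf s).continuousAt.continuousWithinAt)
    (fun s _ => (hf s).hasDerivWithinAt)
    ((hi.mono_set (Icc_subset_Icc hAx hyB)).const_mul C) hle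
  refine h.trans ?_
  rw [intervalIntegral.integral_const_mul]
  refine mul_le_mul_of_nonneg_left ?_ hC
  refine intervalIntegral.integral_mono_interval hAx hxy hyB
    (Filter.Eventually.of_forall fun s => splitWeight_nonneg _ _ _) ?_
  exact (intervalIntegrable_iff_integrableOn_Icc_of_le (hAx.trans (hxy.trans hyB))).2 hi

end Weight

lemma two_div_rpow_lt {α₁ α₂ M Q R s l m L : ℝ} (hα₁ : 0 < α₁) (hα₂ : 0 < α₂) (hM : 0 < M)
    (hR : 0 ≤ R) (hRQ : R ^ α₂ = M ^ (α₁ * α₂) * Q) (hl : 0 ≤ l) (hlm : l < m) (hmL : m ≤ L / 2)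
    (hMs : M ≤ s * m) (hs : signedPow α₁ s ≤ R * l) :
    (2 / L) ^ (α₂ * (α₁ + 1)) < Q := by
  have hm : 0 < m := hl.trans_lt hlm
  have hs0 : 0 < s := pos_of_mul_pos_left (hM.trans_le hMs) hm.le
  rw [signedPow_of_pos hs0] at hs
  have hR0 : 0 < R := by
    have := Real.rpow_pos_of_pos hs0 α₁
    by_contra h
    have : R = 0 := le_antisymm (not_lt.1 h) hR
    subst this
    linarith
  have h1 : M ^ α₁ < R * m ^ (α₁ + 1) := calc
    M ^ α₁ ≤ (s * m) ^ α₁ := Real.rpow_le_rpow hM.le hMs hα₁.le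
    _ = s ^ α₁ * m ^ α₁ := Real.mul_rpow hs0.le hm.le
    _ < (R * m) * m ^ α₁ := by
      have := mul_lt_mul_of_pos_left hlm hR0
      exact mul_lt_mul_of_pos_right (by linarith) (Real.rpow_pos_of_pos hm _)
    _ = R * m ^ (α₁ + 1) := by rw [Real.rpow_add_one hm.ne']; ring
  have h2 := Real.rpow_lt_rpow (Real.rpow_nonneg hM.le _) h1 hα₂
  rw [Real.mul_rpow hR (Real.rpow_nonneg hm.le _), hRQ, ← Real.rpow_mul hM.le,
    ← Real.rpow_mul hm.le, mul_assoc] at h2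
  have h3 : 1 < Q * m ^ ((α₁ + 1) * α₂) := by
    have hP := Real.rpow_pos_of_pos hM (α₁ * α₂)
    exact (lt_mul_iff_one_lt_right hP).1 h2
  have hQ : 0 < Q := pos_of_mul_pos_left (one_pos.trans h3) (Real.rpow_nonneg hm.le _)
  have hL : 0 < L := by linarith
  have h4 : 1 < Q * (L / 2) ^ (α₂ * (α₁ + 1)) := by
    rw [mul_comm α₂]
    refine h3.trans_le (mul_le_mul_of_nonneg_left ?_ hQ.le)
    exact Real.rpow_le_rpow hm.le hmL (by positivity)
  rw [← inv_div, Real.inv_rpow (by positivity), inv_lt_iff_one_lt_mul₀ (by positivity)]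
  linarith

/-- `u` solves the quasilinear equation on `[A, B]`, with `u'`, `D` and `w'` the derivatives of
`u`, `φ_{α₁}(u')` and `φ_{α₂}(D)`. -/
structure IsQuasilinearSolution (α₁ α₂ A B : ℝ) (q u u' D w' : ℝ → ℝ) : Prop where
  hasDerivAt_fst : ∀ x, HasDerivAt u (u' x) x
  hasDerivAt_snd : ∀ x, HasDerivAt (fun y => signedPow α₁ (u' y)) (D x) x
  hasDerivAt_thd : ∀ x, HasDerivAt (fun y => signedPow α₂ (D y)) (w' x) x
  eq : ∀ x ∈ Icc A B, w' x + q x * signedPow (α₁ * α₂) (u x) = 0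

namespace IsQuasilinearSolution

variable {α₁ α₂ A B T : ℝ} {q u u' D w' : ℝ → ℝ}

lemma neg (h : IsQuasilinearSolution α₁ α₂ A B q u u' D w') :
    IsQuasilinearSolution α₁ α₂ A B q (-u) (-u') (-D) (-w') where
  hasDerivAt_fst x := (h.hasDerivAt_fst x).neg
  hasDerivAt_snd x := by simpa [signedPow_neg] using (h.hasDerivAt_snd x).fun_neg
  hasDerivAt_thd x := by simpa [signedPow_neg] using (h.hasDerivAt_thd x).fun_neg
  eq x hx := by simp only [Pi.neg_apply, signedPow_neg]; linarith [h.eq x hx]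

lemma continuous (h : IsQuasilinearSolution α₁ α₂ A B q u u' D w') : Continuous u :=
  continuous_iff_continuousAt.2 fun x => (h.hasDerivAt_fst x).continuousAt

lemma exists_fst_eq (h : IsQuasilinearSolution α₁ α₂ A B q u u' D w') {x y : ℝ} (hxy : x < y) :
    ∃ η ∈ Ioo x y, u y - u x = u' η * (y - x) := by
  obtain ⟨η, hη, e⟩ := exists_hasDerivAt_eq_slope u u' hxy h.continuous.continuousOn
    fun s _ => h.hasDerivAt_fst s
  exact ⟨η, hη, by rw [e, div_mul_cancel₀ _ (sub_pos.2 hxy).ne']⟩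

lemma exists_snd_eq (h : IsQuasilinearSolution α₁ α₂ A B q u u' D w') {x y : ℝ} (hxy : x < y) :
    ∃ η ∈ Ioo x y, signedPow α₁ (u' y) - signedPow α₁ (u' x) = D η * (y - x) := by
  obtain ⟨η, hη, e⟩ := exists_hasDerivAt_eq_slope _ D hxy
    (fun s _ => (h.hasDerivAt_snd s).continuousAt.continuousWithinAt)
    fun s _ => h.hasDerivAt_snd s
  exact ⟨η, hη, by rw [e, div_mul_cancel₀ _ (sub_pos.2 hxy).ne']⟩

lemma exists_D_eq_zero (h : IsQuasilinearSolution α₁ α₂ A B q u u' D w') {x y : ℝ} (hxy : x < y)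
    (hx : u' x = 0) (hy : u' y = 0) : ∃ d ∈ Ioo x y, D d = 0 := by
  obtain ⟨d, hd, e⟩ := h.exists_snd_eq hxy
  refine ⟨d, hd, ?_⟩
  have := sub_pos.2 hxy
  simpa [hx, hy, this.ne'] using e

/-- If a zero of `u'` lies at the right end and `D ≥ -R`, then `φ_{α₁}(u')` grows at most
linearly to the left of it. -/
lemma signedPow_le_left (h : IsQuasilinearSolution α₁ α₂ A B q u u' D w') {x c R : ℝ}
    (hxc : x < c) (hc : u' c = 0) (hD : ∀ s ∈ Ioo x c, -R ≤ D s) :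
    signedPow α₁ (u' x) ≤ R * (c - x) := by
  obtain ⟨η, hη, e⟩ := h.exists_snd_eq hxc
  have := mul_le_mul_of_nonneg_right (hD η hη) (sub_pos.2 hxc).le
  rw [hc, signedPow_zero] at e
  linarith

lemma signedPow_le_right (h : IsQuasilinearSolution α₁ α₂ A B q u u' D w') {x c R : ℝ}
    (hcx : c < x) (hc : u' c = 0) (hD : ∀ s ∈ Ioo c x, D s ≤ R) :
    signedPow α₁ (u' x) ≤ R * (x - c) := by
  obtain ⟨η, hη, e⟩ := h.exists_snd_eq hcx
  have := mul_le_mul_of_nonneg_right (hD η hη) (sub_pos.2 hcx).le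
  rw [hc, signedPow_zero] at e
  linarith

lemma exists_radius {M Q : ℝ} (hα₂ : 0 < α₂) (hM : 0 < M) (hQ : 0 ≤ Q) :
    ∃ R : ℝ, 0 ≤ R ∧ R ^ α₂ = M ^ (α₁ * α₂) * Q :=
  ⟨(M ^ (α₁ * α₂) * Q) ^ α₂⁻¹, by positivity, Real.rpow_inv_rpow (by positivity) hα₂.ne'⟩

/-- The estimate when `u` does not change sign at the middle zero. -/
theorem exists_split_of_same_sign (h : IsQuasilinearSolution α₁ α₂ A B q u u' D w')
    (hα₁ : 0 < α₁) (hα₂ : 0 < α₂) (hq : ContinuousOn q (Icc A B)) (hAT : A < T) (hTB : T < B)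
    (hA : u A = 0) (hT : u T = 0) (hB : u B = 0) (hl : ∀ x ∈ Ioo A T, 0 < u x)
    (hr : ∀ x ∈ Ioo T B, 0 < u x) :
    ∃ ξ ∈ Icc A B, (2 / (B - A)) ^ (α₂ * (α₁ + 1)) < ∫ s in A..B, splitWeight q ξ s := by
  have hnn : ∀ x ∈ Icc A B, 0 ≤ u x := by
    intro x hx
    rcases hx.1.eq_or_lt with rfl | h1
    · exact hA.ge
    rcases hx.2.eq_or_lt with rfl | h2
    · exact hB.ge
    rcases lt_trichotomy x T with h3 | rfl | h3
    · exact (hl x ⟨h1, h3⟩).le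
    · exact hT.ge
    · exact (hr x ⟨h3, h2⟩).le
  obtain ⟨c, hc, hmax⟩ := isCompact_Icc.exists_isMaxOn (nonempty_Icc.2 (hAT.trans hTB).le)
    h.continuous.continuousOn
  have hM : 0 < u c := by
    obtain ⟨z, hz⟩ := nonempty_Ioo.2 hAT
    exact (hl z hz).trans_le (hmax ⟨hz.1.le, hz.2.le.trans hTB.le⟩)
  have hAc : A < c := lt_of_le_of_ne hc.1 (by rintro rfl; exact hM.ne' hA)
  have hcB : c < B := lt_of_le_of_ne hc.2 (by rintro rfl; exact hM.ne' hB)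
  have hcT : c ≠ T := by rintro rfl; exact hM.ne' hT
  have hc' : u' c = 0 :=
    (hmax.isLocalMax (Icc_mem_nhds hAc hcB)).hasDerivAt_eq_zero (h.hasDerivAt_fst c)
  have hT' : u' T = 0 := by
    have hmin : IsMinOn u (Icc A B) T := fun x hx => by
      rw [mem_ofPred_eq, hT]; exact hnn x hx
    exact (hmin.isLocalMin (Icc_mem_nhds hAT hTB)).hasDerivAt_eq_zero (h.hasDerivAt_fst T)
  obtain ⟨d, hd, hDd⟩ : ∃ d ∈ Icc A B, D d = 0 := by
    rcases hcT.lt_or_gt with h1 | h1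
    · obtain ⟨d, hd, e⟩ := h.exists_D_eq_zero h1 hc' hT'
      exact ⟨d, ⟨by linarith [hd.1], by linarith [hd.2]⟩, e⟩
    · obtain ⟨d, hd, e⟩ := h.exists_D_eq_zero h1 hT' hc'
      exact ⟨d, ⟨by linarith [hd.1], by linarith [hd.2]⟩, e⟩
  refine ⟨d, hd, ?_⟩
  set Q := ∫ s in A..B, splitWeight q d s with hQdef
  obtain ⟨R, hR, hRQ⟩ := exists_radius (α₁ := α₁) (Q := Q) hα₂ hM
    (integral_splitWeight_nonneg (hAT.trans hTB).le)
  have hγ : 0 < α₁ * α₂ := mul_pos hα₁ hα₂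
  have hpow : ∀ s ∈ Icc A B, 0 ≤ signedPow (α₁ * α₂) (u s) ∧
      signedPow (α₁ * α₂) (u s) ≤ u c ^ (α₁ * α₂) := fun s hs =>
    ⟨signedPow_nonneg (hnn s hs), signedPow_le hγ hM.le (hmax hs)⟩
  have hD : ∀ s ∈ Icc A B, -R ≤ D s := by
    intro x hx
    suffices H : -D x ≤ R by linarith
    refine le_of_signedPow_le hα₂ hR ?_
    rw [hRQ, signedPow_neg]
    rcases le_total x d with hxd | hxd
    · have := sub_le_mul_integral_splitWeight (ξ := d) hq
        (Real.rpow_nonneg hM.le (α₁ * α₂)) h.hasDerivAt_thd hx.1 hxd hd.2 (fun s hs => by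
          have hs' : s ∈ Icc A B := ⟨hx.1.trans hs.1.le, hs.2.le.trans hd.2⟩
          obtain ⟨h0, h1⟩ := hpow s hs'
          have e := h.eq s hs'
          rw [splitWeight, if_pos hs.2.le]
          calc w' s = signedPow (α₁ * α₂) (u s) * (-q s) := by linarith
            _ ≤ signedPow (α₁ * α₂) (u s) * max (-q s) 0 :=
              mul_le_mul_of_nonneg_left (le_max_left _ _) h0
            _ ≤ _ := mul_le_mul_of_nonneg_right h1 (le_max_right _ _))
      simpa [hDd] using this
    · have := sub_le_mul_integral_splitWeight (ξ := d) hq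
        (Real.rpow_nonneg hM.le (α₁ * α₂)) (fun s => (h.hasDerivAt_thd s).fun_neg) hd.1 hxd hx.2
        (fun s hs => by
          have hs' : s ∈ Icc A B := ⟨hd.1.trans hs.1.le, hs.2.le.trans hx.2⟩
          obtain ⟨h0, h1⟩ := hpow s hs'
          have e := h.eq s hs'
          rw [splitWeight, if_neg (not_le.2 hs.1)]
          calc -w' s = signedPow (α₁ * α₂) (u s) * q s := by linarith
            _ ≤ signedPow (α₁ * α₂) (u s) * max (q s) 0 :=
              mul_le_mul_of_nonneg_left (le_max_left _ _) h0
            _ ≤ _ := mul_le_mul_of_nonneg_right h1 (le_max_right _ _))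
      simpa [hDd] using this
  rcases le_total (c - A) ((B - A) / 2) with hm | hm
  · obtain ⟨η, hη, e⟩ := h.exists_fst_eq hAc
    refine two_div_rpow_lt hα₁ hα₂ hM hR hRQ (sub_nonneg.2 hη.2.le) (by linarith [hη.1]) hm
      (by linarith) (h.signedPow_le_left hη.2 hc' fun s hs => hD s ⟨?_, ?_⟩)
    · linarith [hs.1, hη.1]
    · linarith [hs.2]
  · obtain ⟨η, hη, e⟩ := h.exists_fst_eq hcB
    refine two_div_rpow_lt hα₁ hα₂ hM hR hRQ (sub_nonneg.2 hη.1.le)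
      (show η - c < B - c by linarith [hη.2]) (by linarith)
      (s := -u' η) (by linarith)
      (h.neg.signedPow_le_right hη.1 (by simp [hc']) fun s hs => ?_)
    have := hD s ⟨by linarith [hs.1], by linarith [hs.2, hη.2]⟩
    simpa using neg_le_neg this

/-- The estimate when `u` changes sign at the middle zero. -/
theorem exists_split_of_opposite_sign (h : IsQuasilinearSolution α₁ α₂ A B q u u' D w')
    (hα₁ : 0 < α₁) (hα₂ : 0 < α₂) (hq : ContinuousOn q (Icc A B)) (hAT : A < T) (hTB : T < B)
    (hA : u A = 0) (hT : u T = 0) (hB : u B = 0) (hl : ∀ x ∈ Ioo A T, 0 < u x)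
    (hr : ∀ x ∈ Ioo T B, u x < 0) :
    ∃ ξ ∈ Icc A B, (2 / (B - A)) ^ (α₂ * (α₁ + 1)) < ∫ s in A..B, splitWeight q ξ s := by
  have hTAB : T ∈ Icc A B := ⟨hAT.le, hTB.le⟩
  obtain ⟨c, hc, hmax⟩ := isCompact_Icc.exists_isMaxOn (nonempty_Icc.2 hAT.le)
    h.continuous.continuousOn
  obtain ⟨e, he, hmin⟩ := isCompact_Icc.exists_isMinOn (nonempty_Icc.2 hTB.le)
    h.continuous.continuousOn
  have huc : 0 < u c := by
    obtain ⟨z, hz⟩ := nonempty_Ioo.2 hAT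
    exact (hl z hz).trans_le (hmax (Ioo_subset_Icc_self hz))
  have hue : u e < 0 := by
    obtain ⟨z, hz⟩ := nonempty_Ioo.2 hTB
    exact (hmin (Ioo_subset_Icc_self hz)).trans_lt (hr z hz)
  have hAc : A < c := lt_of_le_of_ne hc.1 (by rintro rfl; exact huc.ne' hA)
  have hcT : c < T := lt_of_le_of_ne hc.2 (by rintro rfl; exact huc.ne' hT)
  have hTe : T < e := lt_of_le_of_ne he.1 (by rintro rfl; exact hue.ne hT)
  have heB : e < B := lt_of_le_of_ne he.2 (by rintro rfl; exact hue.ne hB)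
  have hc' : u' c = 0 :=
    (hmax.isLocalMax (Icc_mem_nhds hAc hcT)).hasDerivAt_eq_zero (h.hasDerivAt_fst c)
  have he' : u' e = 0 :=
    (hmin.isLocalMin (Icc_mem_nhds hTe heB)).hasDerivAt_eq_zero (h.hasDerivAt_fst e)
  obtain ⟨d, hd, hDd⟩ := h.exists_D_eq_zero (hcT.trans hTe) hc' he'
  refine ⟨T, hTAB, ?_⟩
  set M := max (u c) (-u e) with hMdef
  have hM : 0 < M := huc.trans_le (le_max_left _ _)
  set Q := ∫ s in A..B, splitWeight q T s with hQdef
  obtain ⟨R, hR, hRQ⟩ := exists_radius (α₁ := α₁) (Q := Q) hα₂ hM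
    (integral_splitWeight_nonneg (hAT.trans hTB).le)
  have hγ : 0 < α₁ * α₂ := mul_pos hα₁ hα₂
  have hw' : ∀ s ∈ Ioo A B, w' s ≤ M ^ (α₁ * α₂) * splitWeight q T s := by
    intro s hs
    have eqn := h.eq s (Ioo_subset_Icc_self hs)
    rcases le_or_gt s T with hsT | hsT
    · have hus : 0 ≤ u s := by
        rcases hsT.eq_or_lt with rfl | h1
        · exact hT.ge
        · exact (hl s ⟨hs.1, h1⟩).le
      have h0 := signedPow_nonneg (p := α₁ * α₂) hus
      have h1 := signedPow_le hγ hM.le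
        (show u s ≤ M from (hmax ⟨hs.1.le, hsT⟩).trans (le_max_left _ _))
      rw [splitWeight, if_pos hsT]
      calc w' s = signedPow (α₁ * α₂) (u s) * (-q s) := by linarith
        _ ≤ signedPow (α₁ * α₂) (u s) * max (-q s) 0 :=
          mul_le_mul_of_nonneg_left (le_max_left _ _) h0
        _ ≤ _ := mul_le_mul_of_nonneg_right h1 (le_max_right _ _)
    · have h0 := signedPow_nonneg (p := α₁ * α₂) (neg_nonneg.2 (hr s ⟨hsT, hs.2⟩).le)
      have h1 := signedPow_le hγ hM.le
        (show -u s ≤ M from (neg_le_neg (hmin ⟨hsT.le, hs.2.le⟩)).trans (le_max_right _ _))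
      rw [splitWeight, if_neg (not_le.2 hsT)]
      calc w' s = signedPow (α₁ * α₂) (-u s) * q s := by rw [signedPow_neg]; linarith
        _ ≤ signedPow (α₁ * α₂) (-u s) * max (q s) 0 :=
          mul_le_mul_of_nonneg_left (le_max_left _ _) h0
        _ ≤ _ := mul_le_mul_of_nonneg_right h1 (le_max_right _ _)
  have hDr : ∀ x, d ≤ x → x ≤ B → D x ≤ R := by
    intro x hdx hxB
    refine le_of_signedPow_le hα₂ hR ?_
    have hAd : A ≤ d := by linarith [hd.1]
    have := sub_le_mul_integral_splitWeight (ξ := T) hq (Real.rpow_nonneg hM.le (α₁ * α₂))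
      h.hasDerivAt_thd hAd hdx hxB
      fun s hs => hw' s ⟨hAd.trans_lt hs.1, hs.2.trans_le hxB⟩
    rw [hRQ]
    simpa [hDd] using this
  have hDl : ∀ x, A ≤ x → x ≤ d → -R ≤ D x := by
    intro x hAx hxd
    suffices H : -D x ≤ R by linarith
    refine le_of_signedPow_le hα₂ hR ?_
    have hdB : d ≤ B := by linarith [hd.2]
    have := sub_le_mul_integral_splitWeight (ξ := T) hq (Real.rpow_nonneg hM.le (α₁ * α₂))
      h.hasDerivAt_thd hAx hxd hdB
      fun s hs => hw' s ⟨hAx.trans_lt hs.1, hs.2.trans_le hdB⟩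
    rw [hRQ, signedPow_neg]
    simpa [hDd] using this
  have hmid : ∀ x ∈ Ioo c e, ∃ l, 0 ≤ l ∧ l < e - c ∧ signedPow α₁ (-u' x) ≤ R * l := by
    intro x hx
    rcases le_total x d with hxd | hxd
    · refine ⟨x - c, by linarith [hx.1], by linarith [hx.2],
        h.neg.signedPow_le_right hx.1 (by simp [hc']) fun s hs => ?_⟩
      simpa using neg_le_neg (hDl s (by linarith [hs.1]) (by linarith [hs.2]))
    · refine ⟨e - x, by linarith [hx.2], by linarith [hx.1],
        h.neg.signedPow_le_left hx.2 (by simp [he']) fun s hs => ?_⟩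
      simpa using hDr s (by linarith [hs.1]) (by linarith [hs.2])
  rcases max_choice (u c) (-u e) with hmx | hmx
  · rcases le_or_gt (c - A) ((B - A) / 2) with hm | hm
    · obtain ⟨η, hη, eη⟩ := h.exists_fst_eq hAc
      refine two_div_rpow_lt hα₁ hα₂ hM hR hRQ (sub_nonneg.2 hη.2.le) (by linarith [hη.1]) hm
        (by linarith) (h.signedPow_le_left hη.2 hc' fun s hs => hDl s ?_ ?_)
      · linarith [hs.1, hη.1]
      · linarith [hs.2, hd.1]
    · obtain ⟨η, hη, eη⟩ := h.exists_fst_eq hcT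
      obtain ⟨l, hl0, hl1, hl2⟩ := hmid η ⟨hη.1, hη.2.trans hTe⟩
      have hMe : M = -u' η * (T - c) := by linarith
      have hη0 : 0 < -u' η := pos_of_mul_pos_left (hMe ▸ hM) (sub_pos.2 hcT).le
      refine two_div_rpow_lt hα₁ hα₂ hM hR hRQ hl0 hl1 (by linarith) ?_ hl2
      rw [hMe]
      exact mul_le_mul_of_nonneg_left (by linarith) hη0.le
  · rcases le_or_gt (B - e) ((B - A) / 2) with hm | hm
    · obtain ⟨η, hη, eη⟩ := h.exists_fst_eq heB
      refine two_div_rpow_lt hα₁ hα₂ hM hR hRQ (sub_nonneg.2 hη.1.le) (by linarith [hη.2]) hm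
        (by linarith) (h.signedPow_le_right hη.1 he' fun s hs => hDr s ?_ ?_)
      · linarith [hs.1, hd.2]
      · linarith [hs.2, hη.2]
    · obtain ⟨η, hη, eη⟩ := h.exists_fst_eq hTe
      obtain ⟨l, hl0, hl1, hl2⟩ := hmid η ⟨hcT.trans hη.1, hη.2⟩
      have hMe : M = -u' η * (e - T) := by linarith
      have hη0 : 0 < -u' η := pos_of_mul_pos_left (hMe ▸ hM) (sub_pos.2 hTe).le
      refine two_div_rpow_lt hα₁ hα₂ hM hR hRQ hl0 hl1 (by linarith) ?_ hl2
      rw [hMe]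
      exact mul_le_mul_of_nonneg_left (by linarith) hη0.le

lemma pos_or_neg_on_Ioo {f : ℝ → ℝ} (hf : Continuous f) {x y : ℝ}
    (hne : ∀ s ∈ Ioo x y, f s ≠ 0) :
    (∀ s ∈ Ioo x y, 0 < f s) ∨ ∀ s ∈ Ioo x y, f s < 0 := by
  by_contra! ⟨⟨s, hs, hs0⟩, r, hr, hr0⟩
  obtain ⟨z, hz, hz0⟩ := isPreconnected_Ioo.intermediate_value hs hr hf.continuousOn
    (show (0 : ℝ) ∈ Icc (f s) (f r) from ⟨hs0, hr0⟩)
  exact hne z hz hz0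

theorem exists_split (h : IsQuasilinearSolution α₁ α₂ A B q u u' D w')
    (hα₁ : 0 < α₁) (hα₂ : 0 < α₂) (hq : ContinuousOn q (Icc A B)) (hAT : A < T) (hTB : T < B)
    (hA : u A = 0) (hT : u T = 0) (hB : u B = 0) (hl : ∀ x ∈ Ioo A T, u x ≠ 0)
    (hr : ∀ x ∈ Ioo T B, u x ≠ 0) :
    ∃ ξ ∈ Icc A B, (2 / (B - A)) ^ (α₂ * (α₁ + 1)) <
      (∫ s in A..ξ, max (-q s) 0) + ∫ s in ξ..B, max (q s) 0 := by
  suffices H : ∃ ξ ∈ Icc A B,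
      (2 / (B - A)) ^ (α₂ * (α₁ + 1)) < ∫ s in A..B, splitWeight q ξ s by
    obtain ⟨ξ, hξ, hlt⟩ := H
    exact ⟨ξ, hξ, integral_splitWeight hq hξ ▸ hlt⟩
  have hA' : (-u) A = 0 := by simp [hA]
  have hT' : (-u) T = 0 := by simp [hT]
  have hB' : (-u) B = 0 := by simp [hB]
  rcases pos_or_neg_on_Ioo h.continuous hl with h1 | h1 <;>
    rcases pos_or_neg_on_Ioo h.continuous hr with h2 | h2
  · exact h.exists_split_of_same_sign hα₁ hα₂ hq hAT hTB hA hT hB h1 h2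
  · exact h.exists_split_of_opposite_sign hα₁ hα₂ hq hAT hTB hA hT hB h1 h2
  · exact h.neg.exists_split_of_opposite_sign hα₁ hα₂ hq hAT hTB hA' hT' hB'
      (fun x hx => neg_pos.2 (h1 x hx)) (fun x hx => neg_neg_iff_pos.2 (h2 x hx))
  · exact h.neg.exists_split_of_same_sign hα₁ hα₂ hq hAT hTB hA' hT' hB'
      (fun x hx => neg_pos.2 (h1 x hx)) (fun x hx => neg_pos.2 (h2 x hx))

end IsQuasilinearSolution

/-- Jensen's inequality for the power `x ^ (-e)`. -/
lemma le_sum_two_div_rpow {N : ℕ} (hN : 1 ≤ N) {e C : ℝ} (he : 0 < e) (hC : 0 < C) (L : ℕ → ℝ)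
    (hL : ∀ k ∈ Finset.Icc 1 N, 0 < L k) (hsum : ∑ k ∈ Finset.Icc 1 N, L k ≤ C) :
    (2 / C) ^ e * (N : ℝ) ^ (e + 1) ≤ ∑ k ∈ Finset.Icc 1 N, (2 / L k) ^ e := by
  have hN0 : (0 : ℝ) < N := by exact_mod_cast hN
  set m := C / N with hm
  have hm0 : 0 < m := by positivity
  have key : ∀ k ∈ Finset.Icc 1 N,
      (2 / m) ^ e * (1 - e * (L k / m - 1)) ≤ (2 / L k) ^ e := by
    intro k hk
    have hLk := hL k hk
    have hy : 0 < L k / m := by positivity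
    have h1 : (2 / L k) ^ e = (2 / m) ^ e * ((L k / m)⁻¹) ^ e := by
      rw [← Real.mul_rpow (by positivity) (by positivity)]
      congr 1
      field_simp
    rw [h1]
    refine mul_le_mul_of_nonneg_left ?_ (by positivity)
    rw [Real.rpow_def_of_pos (by positivity), Real.log_inv]
    have h2 := Real.log_le_sub_one_of_pos hy
    have h3 := Real.add_one_le_exp (-Real.log (L k / m) * e)
    nlinarith [mul_le_mul_of_nonneg_left h2 he.le]
  refine le_trans ?_ (Finset.sum_le_sum key)
  rw [← Finset.mul_sum, Finset.sum_sub_distrib, ← Finset.mul_sum, Finset.sum_sub_distrib,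
    ← Finset.sum_div]
  have h4 : (2 / C) ^ e * (N : ℝ) ^ (e + 1) = (2 / m) ^ e * N := by
    rw [Real.rpow_add_one hN0.ne', ← mul_assoc, ← Real.mul_rpow (by positivity) (by positivity)]
    congr 2
    rw [hm]
    field_simp
  rw [h4]
  refine mul_le_mul_of_nonneg_left ?_ (by positivity)
  have h5 : (∑ k ∈ Finset.Icc 1 N, L k) / m ≤ N := by
    rw [div_le_iff₀ hm0, hm, mul_div_cancel₀ _ hN0.ne']
    exact hsum
  simp only [Finset.sum_const, Nat.card_Icc, Nat.add_sub_cancel, nsmul_eq_mul, mul_one]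
  nlinarith

lemma sum_Icc_sub_eq (t : ℕ → ℝ) (N : ℕ) :
    ∑ k ∈ Finset.Icc 1 N, (t (2 * k + 1) - t (2 * k - 1)) = t (2 * N + 1) - t 1 := by
  induction N with
  | zero => simp
  | succ n ih =>
    rw [Finset.sum_Icc_succ_top (by omega), ih, show 2 * (n + 1) - 1 = 2 * n + 1 by omega]
    ring

theorem quasilinear_zero_count
    (α₁ α₂ a b : ℝ) (q u : ℝ → ℝ) (N : ℕ) (t : ℕ → ℝ)
    (hα₁ : 0 < α₁) (hα₂ : 0 < α₂) (hab : a < b) (hN : 1 ≤ N)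
    (hq : ContinuousOn q (Icc a b))
    (hu : Differentiable ℝ u)
    (hu1 : Differentiable ℝ (fun x => |deriv u x| ^ (α₁ - 1) * deriv u x))
    (hu2 : Differentiable ℝ (fun x =>
      |deriv (fun y => |deriv u y| ^ (α₁ - 1) * deriv u y) x| ^ (α₂ - 1) *
        deriv (fun y => |deriv u y| ^ (α₁ - 1) * deriv u y) x))
    (hode : ∀ x ∈ Icc a b,
      deriv (fun y =>
        |deriv (fun z => |deriv u z| ^ (α₁ - 1) * deriv u z) y| ^ (α₂ - 1) *
          deriv (fun z => |deriv u z| ^ (α₁ - 1) * deriv u z) y) x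
        + q x * (|u x| ^ (α₁ * α₂ - 1) * u x) = 0)
    (hnontriv : ∃ x ∈ Icc a b, u x ≠ 0)
    (htmem : ∀ k, 1 ≤ k → k ≤ 2 * N + 1 → t k ∈ Icc a b)
    (htmono : ∀ k, 1 ≤ k → k < 2 * N + 1 → t k < t (k + 1))
    (htz : ∀ k, 1 ≤ k → k ≤ 2 * N + 1 → u (t k) = 0)
    (htbetween : ∀ k, 1 ≤ k → k < 2 * N + 1 →
      ∀ x ∈ Ioo (t k) (t (k + 1)), u x ≠ 0) :
    ∃ ξ : ℕ → ℝ,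
      (∀ k ∈ Finset.Icc 1 N, ξ k ∈ Icc (t (2 * k - 1)) (t (2 * k + 1))) ∧
      (2 / (b - a)) ^ (α₂ * (α₁ + 1)) * (N : ℝ) ^ (α₂ * (α₁ + 1) + 1) <
        ∑ k ∈ Finset.Icc 1 N,
          ((∫ x in t (2 * k - 1)..ξ k, max (-q x) 0) +
            (∫ x in ξ k..t (2 * k + 1), max (q x) 0)) := by
  have hsol : IsQuasilinearSolution α₁ α₂ a b q u (deriv u)
      (deriv fun y => signedPow α₁ (deriv u y))
      (deriv fun y => signedPow α₂ (deriv (fun z => signedPow α₁ (deriv u z)) y)) :=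
    ⟨fun x => (hu x).hasDerivAt, fun x => (hu1 x).hasDerivAt, fun x => (hu2 x).hasDerivAt, hode⟩
  have hstep : ∀ k ∈ Finset.Icc 1 N,
      t (2 * k - 1) < t (2 * k) ∧ t (2 * k) < t (2 * k + 1) := by
    intro k hk
    rw [Finset.mem_Icc] at hk
    have h1 := htmono (2 * k - 1) (by omega) (by omega)
    rw [show 2 * k - 1 + 1 = 2 * k by omega] at h1
    exact ⟨h1, htmono (2 * k) (by omega) (by omega)⟩
  have hex : ∀ k, ∃ ξ, k ∈ Finset.Icc 1 N → ξ ∈ Icc (t (2 * k - 1)) (t (2 * k + 1)) ∧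
      (2 / (t (2 * k + 1) - t (2 * k - 1))) ^ (α₂ * (α₁ + 1)) <
        (∫ x in t (2 * k - 1)..ξ, max (-q x) 0) + ∫ x in ξ..t (2 * k + 1), max (q x) 0 := by
    intro k
    by_cases hk : k ∈ Finset.Icc 1 N
    · obtain ⟨h1, h2⟩ := hstep k hk
      rw [Finset.mem_Icc] at hk
      have hsub : Icc (t (2 * k - 1)) (t (2 * k + 1)) ⊆ Icc a b :=
        Icc_subset_Icc (htmem _ (by omega) (by omega)).1 (htmem _ (by omega) (by omega)).2
      have hne := htbetween (2 * k - 1) (by omega) (by omega)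
      rw [show 2 * k - 1 + 1 = 2 * k by omega] at hne
      obtain ⟨ξ, hξ, hlt⟩ := IsQuasilinearSolution.exists_split
        ⟨hsol.hasDerivAt_fst, hsol.hasDerivAt_snd, hsol.hasDerivAt_thd,
          fun x hx => hsol.eq x (hsub hx)⟩
        hα₁ hα₂ (hq.mono hsub) h1 h2 (htz _ (by omega) (by omega)) (htz _ (by omega) (by omega))
        (htz _ (by omega) (by omega)) hne (htbetween (2 * k) (by omega) (by omega))
      exact ⟨ξ, fun _ => ⟨hξ, hlt⟩⟩
    · exact ⟨0, fun h => absurd h hk⟩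
  choose ξ hξ using hex
  refine ⟨ξ, fun k hk => (hξ k hk).1, ?_⟩
  refine (le_sum_two_div_rpow hN (by positivity) (sub_pos.2 hab)
    (fun k => t (2 * k + 1) - t (2 * k - 1))
    (fun k hk => sub_pos.2 ((hstep k hk).1.trans (hstep k hk).2)) ?_).trans_lt ?_
  · rw [sum_Icc_sub_eq]
    linarith [(htmem (2 * N + 1) (by omega) le_rfl).2, (htmem 1 le_rfl (by omega)).1]
  · exact Finset.sum_lt_sum_of_nonempty (Finset.nonempty_Icc.2 hN) fun k hk => (hξ k hk).2
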